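/- Suppose R is noetherian in codimension 1 and S, S' are both witnessing depictions (i.e., every height-1 prime of S lies in Z_{S/R} and every height-1 prime of S' lies in Z_{S'/R}). Then ⋂_{n ∈ U_{S/R}} S_n = ⋂_{n' ∈ U_{S'/R}} S'_{n'} as subrings of Frac(R). In particular, the ring T := ⋂_{n ∈ U_{S/R}} S_n is the unique maximal depiction of R: it is a depiction of R that contains every depiction of R, and it is independent of the choice of depiction S. -/

import Mathlib

/-! Common framework: depictions of nonnoetherian integral domains (Beil).
`K` plays the role of the fraction field `Frac R`; all rings are `k`-subalgebras of `K`. -/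

section Depictions

variable {k K : Type*} [Field k] [Field K] [Algebra k K]

/-- The localization `A_p` of a subalgebra `A ⊆ K` at a prime ideal `p`,
viewed as a subalgebra of `K`. -/
def locAt (A : Subalgebra k K) (p : Ideal A) (hp : p.IsPrime) : Subalgebra k K where
  carrier := {x : K | ∃ a s : A, s ∉ p ∧ x * (s : K) = (a : K)}
  one_mem' := ⟨1, 1, (Ideal.ne_top_iff_one p).mp hp.ne_top, by simp⟩
  zero_mem' := ⟨0, 1, (Ideal.ne_top_iff_one p).mp hp.ne_top, by simp⟩
  mul_mem' := by
    rintro x y ⟨a, s, hs, hx⟩ ⟨b, t, ht, hy⟩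
    refine ⟨a * b, s * t, fun h => ((hp.mem_or_mem h).elim hs ht), ?_⟩
    have : x * y * ((s : K) * (t : K)) = (x * s) * (y * t) := by ring
    push_cast
    rw [this, hx, hy]
  add_mem' := by
    rintro x y ⟨a, s, hs, hx⟩ ⟨b, t, ht, hy⟩
    refine ⟨a * t + b * s, s * t, fun h => ((hp.mem_or_mem h).elim hs ht), ?_⟩
    have : (x + y) * ((s : K) * (t : K)) = (x * s) * t + (y * t) * s := by ring
    push_cast
    rw [this, hx, hy]
  algebraMap_mem' := fun c =>
    ⟨algebraMap k A c, 1, (Ideal.ne_top_iff_one p).mp hp.ne_top, by simp⟩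

lemma mem_locAt {A : Subalgebra k K} {p : Ideal A} {hp : p.IsPrime} {x : K} :
    x ∈ locAt A p hp ↔ ∃ a s : A, s ∉ p ∧ x * (s : K) = (a : K) := Iff.rfl

/-- `n ∈ U_{S/R}`: `n` is a maximal ideal of `S` with `R_{n ∩ R} = S_n`. -/
def memU (R S : Subalgebra k K) (h : R ≤ S) (n : Ideal S) : Prop :=
  ∃ hn : n.IsMaximal,
    locAt R (n.comap (Subalgebra.inclusion h)) (hn.isPrime.comap _) = locAt S n hn.isPrime

/-- `q ∈ Z_{S/R}`: `q` is a prime of `S` whose zero locus meets `U_{S/R}`,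
i.e. some `n ∈ U_{S/R}` contains `q`. -/
def memZ (R S : Subalgebra k K) (h : R ≤ S) (q : Ideal S) : Prop :=
  q.IsPrime ∧ ∃ n : Ideal S, memU R S h n ∧ q ≤ n

/-- `S` is a depiction of `R`. -/
structure IsDepiction (R S : Subalgebra k K) : Prop where
  le : R ≤ S
  fg : S.FG
  specSurj : ∀ p : Ideal R, p.IsPrime →
    ∃ q : Ideal S, q.IsPrime ∧ q.comap (Subalgebra.inclusion le) = p
  memU_iff : ∀ (n : Ideal S) (hn : n.IsMaximal),
    memU R S le n ↔
      IsNoetherianRing (locAt R (n.comap (Subalgebra.inclusion le)) (hn.isPrime.comap _))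
  nonempty : ∃ n : Ideal S, memU R S le n

/-- The height of an ideal `q`, as the Krull dimension of the set of primes contained in `q`. -/
noncomputable def htOf {A : Type*} [CommRing A] (q : Ideal A) : WithBot ℕ∞ :=
  Order.krullDim {p : PrimeSpectrum A // p.asIdeal ≤ q}

/-- The geometric height of a prime `p` of `R`: the minimum of the heights `ht_S q` over all
depictions `S` of `R` and primes `q` of `S` with `q ∩ R = p`. -/
noncomputable def ght (R : Subalgebra k K) (p : Ideal R) : WithBot ℕ∞ :=
  sInf {h | ∃ (S : Subalgebra k K) (hd : IsDepiction R S) (q : Ideal S),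
    q.IsPrime ∧ q.comap (Subalgebra.inclusion hd.le) = p ∧ h = htOf q}

/-- The geometric dimension of a prime `p` of `R`: `gdim p = dim R - ght p`. -/
noncomputable def gdim (R : Subalgebra k K) (p : Ideal R) : WithBot ℕ∞ :=
  Option.map₂ (· - ·) (ringKrullDim ↥R) (ght R p)

/-- `T := ⋂_{n ∈ U_{S/R}} S_n`, as a subalgebra of `K`. -/
noncomputable def depT (R S : Subalgebra k K) (h : R ≤ S) : Subalgebra k K :=
  sInf {L | ∃ (n : Ideal S) (hn : n.IsMaximal), memU R S h n ∧ L = locAt S n hn.isPrime}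

lemma le_depT (R S : Subalgebra k K) (h : R ≤ S) : S ≤ depT R S h := by
  refine le_sInf ?_
  rintro L ⟨n, hn, -, rfl⟩
  intro x hx
  exact ⟨⟨x, hx⟩, 1, (Ideal.ne_top_iff_one n).mp hn.ne_top, by simp⟩

/-- A depiction `S` of `R` witnesses `noetherian in codimension 1`:
every height 1 prime of `S` lies in `Z_{S/R}`. -/
def Witnessing (R S : Subalgebra k K) (h : R ≤ S) : Prop :=
  ∀ q : Ideal S, q.IsPrime → htOf q = 1 → memZ R S h q

/-- `R` is noetherian in codimension 1. -/
def NoethCodimOne (R : Subalgebra k K) : Prop :=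
  ∃ (S : Subalgebra k K) (hd : IsDepiction R S), Witnessing R S hd.le

/-- A depiction `S` of `R` is saturated if `ght (q ∩ R) = ht_S q` for every prime `q` of `S`
minimal over `(q ∩ R)S`. -/
def IsSaturated (R S : Subalgebra k K) (h : R ≤ S) : Prop :=
  ∀ q : Ideal S,
    q ∈ (Ideal.map (Subalgebra.inclusion h) (q.comap (Subalgebra.inclusion h))).minimalPrimes →
      ght R (q.comap (Subalgebra.inclusion h)) = htOf q

/-- The subalgebra `k + p ⊆ K`, for `p` an ideal of a subalgebra `S ⊆ K`. -/
def kPlus (S : Subalgebra k K) (p : Ideal S) : Subalgebra k K where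
  carrier := {x : K | ∃ (c : k) (f : S), f ∈ p ∧ x = algebraMap k K c + (f : K)}
  one_mem' := ⟨1, 0, p.zero_mem, by simp⟩
  zero_mem' := ⟨0, 0, p.zero_mem, by simp⟩
  mul_mem' := by
    rintro x y ⟨c, f, hf, rfl⟩ ⟨d, g, hg, rfl⟩
    refine ⟨c * d, algebraMap k S c * g + algebraMap k S d * f + f * g,
      add_mem (add_mem (p.mul_mem_left _ hg) (p.mul_mem_left _ hf)) (p.mul_mem_left _ hg),
      ?_⟩
    push_cast
    ring
  add_mem' := by
    rintro x y ⟨c, f, hf, rfl⟩ ⟨d, g, hg, rfl⟩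
    exact ⟨c + d, f + g, add_mem hf hg, by push_cast; ring⟩
  algebraMap_mem' := fun c => ⟨c, 0, p.zero_mem, by simp⟩

lemma kPlus_le (S : Subalgebra k K) (p : Ideal S) : kPlus S p ≤ S := by
  rintro x ⟨c, f, hf, rfl⟩
  exact add_mem (S.algebraMap_mem c) f.2

end Depictions

open scoped nonZeroDivisors

lemma htOf_eq_height {A : Type*} [CommRing A] (q : PrimeSpectrum A) :
    htOf q.asIdeal = (Order.height q : ℕ∞) :=
  (Order.height_eq_krullDim_Iic q).symm

/-- A prime of an integral extension lying over a nonzero principal prime has height one. -/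
lemma htOf_eq_one_of_comap_eq_span {A S : Type*} [CommRing A] [IsDomain A] [IsNoetherianRing A]
    [CommRing S] [IsDomain S] [Algebra A S] [Algebra.IsIntegral A S] {π : A} (hπ : Prime π)
    (q : Ideal S) (hq : q.IsPrime) (h : q.comap (algebraMap A S) = Ideal.span {π})
    (hinj : Function.Injective (algebraMap A S)) : htOf q = 1 := by
  have hp : (Ideal.span {π}).IsPrime := (Ideal.span_singleton_prime hπ.ne_zero).mpr hπ
  have key : Order.height (⟨q, hq⟩ : PrimeSpectrum S) = 1 := by
    apply le_antisymm
    · have hmono : StrictMono (PrimeSpectrum.comap (algebraMap A S)) := fun I J hIJ =>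
        Ideal.IsIntegral.comap_lt_comap (R := A) (I := I.asIdeal) (J := J.asIdeal) hIJ
      refine (Order.height_le_height_apply_of_strictMono _ hmono _).trans ?_
      have e : PrimeSpectrum.comap (algebraMap A S) ⟨q, hq⟩ = ⟨Ideal.span {π}, hp⟩ :=
        PrimeSpectrum.ext h
      rw [e]
      have := Ideal.height_le_one_of_isPrincipal_of_mem_minimalPrimes (Ideal.span {π})
        (Ideal.span {π}) (by simp [Ideal.minimalPrimes_eq_subsingleton_self])
      have e2 := PrimeSpectrum.height_eq_orderHeight ⟨Ideal.span {π}, hp⟩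
      exact e2 ▸ this
    · rw [Order.one_le_iff_ne_zero, Order.height_ne_zero]
      intro hmin
      have hle : (⟨q, hq⟩ : PrimeSpectrum S) ≤ ⟨⊥, Ideal.isPrime_bot⟩ :=
        hmin (show (⊥ : Ideal S) ≤ q from bot_le)
      have : algebraMap A S π ∈ q := by
        rw [← Ideal.mem_comap, h]
        exact Ideal.mem_span_singleton_self π
      have h0 : algebraMap A S π = 0 := hle this
      exact hπ.ne_zero (hinj (by simpa using h0))
  rw [htOf_eq_height ⟨q, hq⟩, key]
  rfl

/-- An element of the fraction field of a UFD which, for each prime `π`, has a denominator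
prime to `π`, lies in the UFD. -/
lemma isInteger_of_forall_prime {A F : Type*} [CommRing A] [IsDomain A]
    [UniqueFactorizationMonoid A] [Field F] [Algebra A F] [IsFractionRing A F] (y : F)
    (h : ∀ π : A, Prime π → ∃ a : A, ¬ π ∣ a ∧ IsLocalization.IsInteger A (a • y)) :
    IsLocalization.IsInteger A y := by
  obtain ⟨u, v, huv, rfl⟩ := IsFractionRing.exists_reduced_fraction A y
  by_cases hv : IsUnit (v : A)
  · obtain ⟨w, hw⟩ := hv
    refine ⟨u * (w⁻¹ : Aˣ), ?_⟩
    rw [eq_comm, IsLocalization.mk'_eq_iff_eq_mul, ← map_mul, ← hw]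
    simp
  · exfalso
    obtain ⟨π, hπ, hd⟩ := WfDvdMonoid.exists_irreducible_factor hv
      (nonZeroDivisors.coe_ne_zero v)
    obtain ⟨a, ha, c, hc⟩ := h π hπ.prime
    have h1 : a * u = v * c := by
      apply IsFractionRing.injective A F
      rw [map_mul, map_mul, hc, Algebra.smul_def, ← mul_assoc, mul_comm (algebraMap A F v),
        mul_assoc, IsLocalization.mk'_spec']
    rcases hπ.prime.dvd_or_dvd (h1 ▸ hd.mul_right c) with h2 | h2
    · exact ha h2
    · exact hπ.not_isUnit (huv h2 hd)

/-- If `S` is a finite extension of a noetherian UFD, then an `S`-submodule of `Frac S` all of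
whose elements lie in the localizations of `S` at height one primes is finitely generated. -/
lemma fg_of_forall_height_one {A S K : Type*} [CommRing A] [IsDomain A] [IsNoetherianRing A]
    [UniqueFactorizationMonoid A] [CommRing S] [IsDomain S] [Algebra A S] [Module.Finite A S]
    [FaithfulSMul A S] [Field K] [Algebra S K] [IsFractionRing S K] [Algebra A K]
    [IsScalarTower A S K] (N : Submodule S K)
    (hN : ∀ x ∈ N, ∀ q : Ideal S, q.IsPrime → htOf q = 1 →
      ∃ s ∉ q, IsLocalization.IsInteger S (s • x)) : N.FG := by
  have hAS := FaithfulSMul.algebraMap_injective A S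
  have : FaithfulSMul A K := by
    rw [faithfulSMul_iff_algebraMap_injective, IsScalarTower.algebraMap_eq A S K]
    exact (IsFractionRing.injective S K).comp hAS
  let F := FractionRing A
  let _ : Algebra F K := FractionRing.liftAlgebra A K
  have : IsScalarTower A F K := inferInstance
  have : Module.Finite F K := Module.Finite.of_isLocalization A S A⁰
  let b := Module.finBasis F K
  obtain ⟨G, hG⟩ := Module.Finite.fg_top (R := A) (M := S)
  obtain ⟨f, hf⟩ := IsLocalization.exist_integer_multiples_of_finite A⁰
    (fun p : G × Fin (Module.finrank F K) => b.repr (algebraMap S K p.1) p.2)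
  let P : Submodule A (Fin (Module.finrank F K) → F) :=
    LinearMap.range (LinearMap.compLeft (Algebra.linearMap A F) (Fin (Module.finrank F K)))
  let ψ : K →ₗ[A] (Fin (Module.finrank F K) → F) :=
    (f : A) • (b.equivFun.toLinearMap.restrictScalars A)
  have hψ : ∀ x i, ψ x i = (f : A) • b.repr x i := fun x i => rfl
  have hψinj : Function.Injective ψ := by
    intro x y hxy
    apply b.repr.injective
    ext i
    have h1 := congrFun hxy i
    rw [hψ, hψ] at h1
    exact smul_right_injective F (nonZeroDivisors.coe_ne_zero f) h1
  have hS : ∀ (s : S) i, IsLocalization.IsInteger A (ψ (algebraMap S K s) i) := by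
    intro s i
    have hs : s ∈ Submodule.span A (G : Set S) := hG ▸ Submodule.mem_top
    induction hs using Submodule.span_induction with
    | mem x hx => exact hf (⟨x, hx⟩, i)
    | zero => simpa using IsLocalization.isInteger_zero
    | add x y _ _ hx hy =>
      rw [map_add, map_add]
      exact IsLocalization.isInteger_add hx hy
    | smul a x _ hx =>
      rw [Algebra.smul_def, map_mul, ← IsScalarTower.algebraMap_apply, ← Algebra.smul_def,
        map_smul]
      exact IsLocalization.isInteger_smul hx
  have hle : (N.restrictScalars A).map ψ ≤ P := by
    rintro _ ⟨x, hx, rfl⟩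
    have hint : ∀ i, IsLocalization.IsInteger A (ψ x i) := by
      intro i
      refine isInteger_of_forall_prime _ fun π hπ => ?_
      let J : Ideal S := (LinearMap.range (Algebra.linearMap S K)).comap
        (LinearMap.toSpanSingleton S K x)
      have hJ : ∀ s, s ∈ J ↔ IsLocalization.IsInteger S (s • x) := fun s => Iff.rfl
      by_contra! hcon
      have hp : (Ideal.span {π}).IsPrime := (Ideal.span_singleton_prime hπ.ne_zero).mpr hπ
      have hJle : J.comap (algebraMap A S) ≤ Ideal.span {π} := by
        intro a ha
        rw [Ideal.mem_span_singleton]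
        by_contra hna
        refine hcon a hna ?_
        obtain ⟨s, hs⟩ := (hJ _).mp (Ideal.mem_comap.mp ha)
        rw [algebraMap_smul] at hs
        have := hS s i
        rwa [hs, map_smul] at this
      obtain ⟨q, hJq, hq, hqA⟩ := Ideal.exists_ideal_over_prime_of_isIntegral _ J hJle
      obtain ⟨s, hs, hsx⟩ := hN x hx q hq (htOf_eq_one_of_comap_eq_span hπ q hq hqA hAS)
      exact hs (hJq ((hJ s).mpr hsx))
    choose c hc using hint
    exact ⟨c, funext hc⟩
  have hfg : ((N.restrictScalars A).map ψ).FG := by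
    have : IsNoetherian A P := inferInstance
    have := isNoetherian_submodule.mp this
    exact this _ hle
  obtain ⟨G', hG'⟩ := Submodule.fg_of_fg_map_injective ψ hψinj hfg
  refine ⟨G', le_antisymm ?_ ?_⟩
  · rw [Submodule.span_le]
    intro x hx
    have : x ∈ N.restrictScalars A := hG' ▸ Submodule.subset_span hx
    exact this
  · intro x hx
    have : x ∈ Submodule.span A (G' : Set K) := hG' ▸ hx
    exact Submodule.span_le_restrictScalars A S _ this

/-- A submodule of the fraction field of an affine domain `S`, all of whose elements lie in the
localizations of `S` at height one primes, is finitely generated. -/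
lemma fg_of_forall_height_one_of_finiteType (k : Type*) {S K : Type*} [Field k] [CommRing S]
    [IsDomain S] [Algebra k S] [Algebra.FiniteType k S] [Field K] [Algebra S K]
    [IsFractionRing S K] (N : Submodule S K)
    (hN : ∀ x ∈ N, ∀ q : Ideal S, q.IsPrime → htOf q = 1 →
      ∃ s ∉ q, IsLocalization.IsInteger S (s • x)) : N.FG := by
  obtain ⟨n, g, hinj, hfin⟩ := exists_finite_inj_algHom_of_fg k S
  let _ : Algebra (MvPolynomial (Fin n) k) S := g.toRingHom.toAlgebra
  let _ : Algebra (MvPolynomial (Fin n) k) K := ((algebraMap S K).comp g.toRingHom).toAlgebra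
  have : IsScalarTower (MvPolynomial (Fin n) k) S K := IsScalarTower.of_algebraMap_eq' rfl
  have : Module.Finite (MvPolynomial (Fin n) k) S := hfin
  have : FaithfulSMul (MvPolynomial (Fin n) k) S :=
    (faithfulSMul_iff_algebraMap_injective _ _).mpr hinj
  exact fg_of_forall_height_one (A := MvPolynomial (Fin n) k) N hN

section Overrings

variable {k K : Type*} [Field k] [Field K] [Algebra k K]

lemma le_locAt (A : Subalgebra k K) (p : Ideal A) (hp : p.IsPrime) : A ≤ locAt A p hp :=
  fun x hx => ⟨⟨x, hx⟩, 1, (Ideal.ne_top_iff_one p).mp hp.ne_top, by simp⟩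

lemma locAt_congr {A : Subalgebra k K} {p q : Ideal A} (h : p = q) (hp : p.IsPrime)
    (hq : q.IsPrime) : locAt A p hp = locAt A q hq := by
  subst h
  rfl

lemma locAt_comap_le {A B : Subalgebra k K} (h : A ≤ B) (q : Ideal B) (hq : q.IsPrime)
    (hp : (q.comap (Subalgebra.inclusion h)).IsPrime) :
    locAt A (q.comap (Subalgebra.inclusion h)) hp ≤ locAt B q hq := by
  rintro x ⟨a, s, hs, hx⟩
  exact ⟨Subalgebra.inclusion h a, Subalgebra.inclusion h s, hs, hx⟩

lemma isNoetherianRing_locAt (A : Subalgebra k K) [IsNoetherianRing A] (p : Ideal A)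
    (hp : p.IsPrime) : IsNoetherianRing (locAt A p hp) := by
  let _ : Algebra A (locAt A p hp) := (Subalgebra.inclusion (le_locAt A p hp)).toRingHom.toAlgebra
  have hcoe : ∀ a : A, ((algebraMap A (locAt A p hp) a : locAt A p hp) : K) = a := fun _ => rfl
  have hne : ∀ s : A, s ∉ p → (s : K) ≠ 0 := fun s hs h0 =>
    hs ((Subtype.ext h0 : s = 0) ▸ p.zero_mem)
  have : IsLocalization p.primeCompl (locAt A p hp) := by
    refine ⟨?_, ?_, ?_⟩
    · rintro ⟨s, hs⟩
      have hs0 := hne s hs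
      refine IsUnit.of_mul_eq_one ⟨(s : K)⁻¹, 1, s, hs, ?_⟩ (Subtype.ext ?_)
      · simp [inv_mul_cancel₀ hs0]
      · change (s : K) * (s : K)⁻¹ = 1
        exact mul_inv_cancel₀ hs0
    · rintro ⟨x, a, s, hs, hx⟩
      exact ⟨⟨a, ⟨s, hs⟩⟩, Subtype.ext hx⟩
    · intro a b hab
      refine ⟨1, ?_⟩
      have : (a : K) = b := congrArg (fun z : locAt A p hp => (z : K)) hab
      rw [Subtype.ext this]
  exact IsLocalization.isNoetherianRing p.primeCompl _ inferInstance

/-- Over any field, maximal ideals of a finitely generated algebra contract to maximal ideals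
of each of its subalgebras. -/
lemma isMaximal_comap_inclusion {R S : Subalgebra k K} (h : R ≤ S) (hS : S.FG) (n : Ideal S)
    (hn : n.IsMaximal) : (n.comap (Subalgebra.inclusion h)).IsMaximal := by
  have : Algebra.FiniteType k S := S.fg_iff_finiteType.mp hS
  let _ : Field (S ⧸ n) := Ideal.Quotient.field n
  have : Module.Finite k (S ⧸ n) := finite_of_finite_type_of_isJacobsonRing k (S ⧸ n)
  have hp := hn.isPrime.comap (Subalgebra.inclusion h)
  let φ : (R ⧸ n.comap (Subalgebra.inclusion h)) →ₐ[k] S ⧸ n :=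
    Ideal.quotientMapₐ n (Subalgebra.inclusion h) le_rfl
  have hφ : Function.Injective φ := Ideal.quotientMap_injective
  have : Algebra.IsIntegral k (R ⧸ n.comap (Subalgebra.inclusion h)) :=
    have : Algebra.IsIntegral k (S ⧸ n) := Algebra.IsIntegral.of_finite k _
    Algebra.IsIntegral.of_injective φ hφ
  exact Ideal.Quotient.maximal_of_isField _ (isField_of_isIntegral_of_isField' (Field.toIsField k))

/-- If all elements of the overring `T` lie in `R_{t ∩ R}`, then `R_{t ∩ R} = T_t`. -/
lemma locAt_comap_eq_of_le {R T : Subalgebra k K} (h : R ≤ T) (t : Ideal T)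
    (ht : t.IsPrime) (hp : (t.comap (Subalgebra.inclusion h)).IsPrime)
    (hT : T ≤ locAt R (t.comap (Subalgebra.inclusion h)) hp) :
    locAt R (t.comap (Subalgebra.inclusion h)) hp = locAt T t ht := by
  refine le_antisymm (locAt_comap_le h t ht hp) ?_
  rintro x ⟨y, z, hz, hx⟩
  obtain ⟨a, s, hs, hzs⟩ := hT z.2
  obtain ⟨b, r, hr, hyr⟩ := hT y.2
  have ha : a ∉ t.comap (Subalgebra.inclusion h) := by
    intro ha
    have hmul : z * Subalgebra.inclusion h s = Subalgebra.inclusion h a := Subtype.ext hzs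
    rcases ht.mem_or_mem (hmul ▸ ha : z * Subalgebra.inclusion h s ∈ t) with h1 | h1
    · exact hz h1
    · exact hs h1
  refine ⟨b * s, r * a, fun hm => (hp.mem_or_mem hm).elim hr ha, ?_⟩
  push_cast
  rw [← hzs, ← hyr, ← hx]
  ring

namespace IsDepiction

variable {R S : Subalgebra k K}

lemma exists_locAt_eq (hd : IsDepiction R S) (m : Ideal R) (hm : m.IsMaximal)
    (hN : IsNoetherianRing (locAt R m hm.isPrime)) :
    ∃ (n : Ideal S) (hn : n.IsMaximal), memU R S hd.le n ∧
      n.comap (Subalgebra.inclusion hd.le) = m ∧ locAt S n hn.isPrime = locAt R m hm.isPrime := by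
  obtain ⟨q, hq, hqm⟩ := hd.specSurj m hm.isPrime
  obtain ⟨n, hn, hqn⟩ := q.exists_le_maximal hq.ne_top
  have hnm : n.comap (Subalgebra.inclusion hd.le) = m :=
    (hm.eq_of_le (hn.isPrime.comap _).ne_top (hqm ▸ Ideal.comap_mono hqn)).symm
  have hU : memU R S hd.le n := by
    rw [hd.memU_iff n hn, locAt_congr hnm _ hm.isPrime]
    exact hN
  obtain ⟨_, hloc⟩ := id hU
  refine ⟨n, hn, hU, hnm, ?_⟩
  rw [← hloc, locAt_congr hnm]

/-- The ring `depT R S` is the intersection of the noetherian localizations of `R` at maximal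
ideals; in particular it does not depend on `S`. -/
lemma mem_depT_iff (hd : IsDepiction R S) (x : K) :
    x ∈ depT R S hd.le ↔ ∀ (m : Ideal R) (hm : m.IsMaximal),
      IsNoetherianRing (locAt R m hm.isPrime) → x ∈ locAt R m hm.isPrime := by
  rw [depT, Algebra.mem_sInf]
  constructor
  · intro hx m hm hN
    obtain ⟨n, hn, hU, -, hloc⟩ := hd.exists_locAt_eq m hm hN
    exact hloc ▸ hx _ ⟨n, hn, hU, rfl⟩
  · rintro hx _ ⟨n, hn, hU, rfl⟩
    have hN := (hd.memU_iff n hn).mp hU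
    obtain ⟨_, hloc⟩ := id hU
    rw [← hloc]
    exact hx _ (isMaximal_comap_inclusion hd.le hd.fg n hn) hN

lemma le_depT_of_isDepiction {S' : Subalgebra k K} (hd : IsDepiction R S)
    (hd' : IsDepiction R S') : S' ≤ depT R S hd.le := by
  intro x hx
  rw [hd.mem_depT_iff]
  intro m hm hN
  obtain ⟨n, hn, -, -, hloc⟩ := hd'.exists_locAt_eq m hm hN
  exact hloc ▸ le_locAt S' n hn.isPrime hx

lemma finite_inclusion_depT [IsFractionRing R K] (hd : IsDepiction R S)
    (hw : Witnessing R S hd.le) :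
    (Subalgebra.inclusion (le_depT R S hd.le)).toRingHom.Finite := by
  have : Algebra.FiniteType k S := S.fg_iff_finiteType.mp hd.fg
  have : IsNoetherianRing S := Algebra.FiniteType.isNoetherianRing k S
  have : IsFractionRing S K := IsFractionRing.of_field S K fun x => by
    obtain ⟨a, b, -, rfl⟩ := IsFractionRing.div_surjective R x
    exact ⟨Subalgebra.inclusion hd.le a, Subalgebra.inclusion hd.le b, rfl⟩
  let _ : Algebra S (depT R S hd.le) :=
    (Subalgebra.inclusion (le_depT R S hd.le)).toRingHom.toAlgebra
  have : IsScalarTower S (depT R S hd.le) K := IsScalarTower.of_algebraMap_eq' rfl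
  let f : depT R S hd.le →ₗ[S] K := (IsScalarTower.toAlgHom S (depT R S hd.le) K).toLinearMap
  have hf : Function.Injective f := Subtype.val_injective
  have hfg : (LinearMap.range f).FG := by
    refine fg_of_forall_height_one_of_finiteType k _ ?_
    rintro _ ⟨x, rfl⟩ q hq hht
    obtain ⟨-, n, hU, hqn⟩ := hw q hq hht
    obtain ⟨hn, -⟩ := id hU
    obtain ⟨a, s, hs, hxs⟩ := Algebra.mem_sInf.mp x.2 _ ⟨n, hn, hU, rfl⟩
    exact ⟨s, fun h => hs (hqn h), a, by rw [Algebra.smul_def, mul_comm]; exact hxs.symm⟩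
  have : Module.Finite S (LinearMap.range f) := Module.Finite.iff_fg.mpr hfg
  exact Module.Finite.equiv (LinearEquiv.ofInjective f hf).symm

lemma isDepiction_depT [IsFractionRing R K] (hd : IsDepiction R S)
    (hw : Witnessing R S hd.le) : IsDepiction R (depT R S hd.le) := by
  have hle := le_depT R S hd.le
  have hfin := hd.finite_inclusion_depT hw
  have hRT : R ≤ depT R S hd.le := hd.le.trans hle
  have hlies : ∀ p : Ideal S, p.IsPrime → ∃ q : Ideal (depT R S hd.le), q.IsPrime ∧
      q.comap (Subalgebra.inclusion hle) = p := by
    intro p hp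
    let _ : Algebra S (depT R S hd.le) := (Subalgebra.inclusion hle).toRingHom.toAlgebra
    have : Module.Finite S (depT R S hd.le) := hfin
    have : FaithfulSMul S (depT R S hd.le) :=
      (faithfulSMul_iff_algebraMap_injective _ _).mpr (Subalgebra.inclusion_injective hle)
    obtain ⟨⟨q, hq, hqp⟩⟩ := Ideal.nonempty_primesOver (S := depT R S hd.le) p
    exact ⟨q, hq, hqp.over.symm⟩
  have hfg : (depT R S hd.le).FG := by
    have : Algebra.FiniteType k S := S.fg_iff_finiteType.mp hd.fg
    let _ : Algebra S (depT R S hd.le) := (Subalgebra.inclusion hle).toRingHom.toAlgebra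
    have : Module.Finite S (depT R S hd.le) := hfin
    have : IsScalarTower k S (depT R S hd.le) := IsScalarTower.of_algebraMap_eq' rfl
    exact (Subalgebra.fg_iff_finiteType _).mpr
      (Algebra.FiniteType.trans (S := S) ‹_› inferInstance)
  have hiff : ∀ (t : Ideal (depT R S hd.le)) (ht : t.IsMaximal),
      memU R (depT R S hd.le) hRT t ↔
        IsNoetherianRing (locAt R (t.comap (Subalgebra.inclusion hRT)) (ht.isPrime.comap _)) := by
    intro t ht
    constructor
    · rintro ⟨_, hloc⟩
      have : Algebra.FiniteType k (depT R S hd.le) := (Subalgebra.fg_iff_finiteType _).mp hfg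
      have : IsNoetherianRing (depT R S hd.le) := Algebra.FiniteType.isNoetherianRing k _
      rw [hloc]
      exact isNoetherianRing_locAt _ t ht.isPrime
    · intro hN
      exact ⟨ht, locAt_comap_eq_of_le hRT t ht.isPrime _ fun x hx =>
        (hd.mem_depT_iff x).mp hx _ (isMaximal_comap_inclusion hRT hfg t ht) hN⟩
  refine ⟨hRT, hfg, ?_, hiff, ?_⟩
  · intro p hp
    obtain ⟨q, hq, rfl⟩ := hd.specSurj p hp
    obtain ⟨t, ht, rfl⟩ := hlies q hq
    exact ⟨t, ht, rfl⟩
  · obtain ⟨n, hU⟩ := hd.nonempty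
    obtain ⟨hn, -⟩ := id hU
    obtain ⟨q, hq, hqn⟩ := hlies n hn.isPrime
    obtain ⟨t, ht, hqt⟩ := q.exists_le_maximal hq.ne_top
    have htn : t.comap (Subalgebra.inclusion hle) = n :=
      (hn.eq_of_le (ht.isPrime.comap _).ne_top (hqn ▸ Ideal.comap_mono hqt)).symm
    subst htn
    exact ⟨t, (hiff t ht).mpr ((hd.memU_iff _ hn).mp hU)⟩

end IsDepiction

end Overrings

/-- If `S` and `S'` are both witnessing depictions of `R` (noetherian in codimension 1), then
`⋂_{n ∈ U_{S/R}} S_n = ⋂_{n' ∈ U_{S'/R}} S'_{n'}`; in particular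
`T := ⋂_{n ∈ U_{S/R}} S_n` is the unique maximal depiction of `R`: it is a depiction of `R`
containing every depiction of `R`, and is independent of the choice of depiction `S`. -/
theorem depT_unique_maximal_depiction (k K : Type*) [Field k] [IsAlgClosed k] [Field K] [Algebra k K]
    (R : Subalgebra k K) (hfrac : IsFractionRing ↥R K)
    (S S' : Subalgebra k K) (hS : IsDepiction R S) (hw : Witnessing R S hS.le)
    (hS' : IsDepiction R S') (hw' : Witnessing R S' hS'.le) :
    depT R S hS.le = depT R S' hS'.le ∧
      IsDepiction R (depT R S hS.le) ∧
      ∀ S'' : Subalgebra k K, IsDepiction R S'' → S'' ≤ depT R S hS.le := by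
  refine ⟨?_, hS.isDepiction_depT hw, fun S'' h => hS.le_depT_of_isDepiction h⟩
  ext x
  rw [hS.mem_depT_iff, hS'.mem_depT_iff]
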